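/- Let (D, R, w, c, (R_i), (D_j)) be a resource allocation instance and let (s, o) be a stable configuration for it. Then s is a lexicographically max-min allocation: s is feasible, and for every demand i, either s i ≥ w i, or there exists a resource j ∈ R_i with ∑_{k ∈ D_j} s k ≥ c j and s i = max{s k : k ∈ D_j}. -/

import Mathlib

open Classical Finset

/-- A resource allocation instance: finite sets `D` of demands and `R` of resources,
nonnegative demand magnitudes `w`, nonnegative capacities `c`, and for each demand `i`
a nonempty set `Ri i` of required resources, such that every resource is required by
at least one demand. -/
structure RAInstance (D R : Type*) [Fintype D] [Fintype R] where
  w : D → ℝ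
  c : R → ℝ
  Ri : D → Finset R
  w_nonneg : ∀ i, 0 ≤ w i
  c_nonneg : ∀ j, 0 ≤ c j
  Ri_nonempty : ∀ i, (Ri i).Nonempty
  Dj_nonempty : ∀ j : R, (Finset.univ.filter fun i => j ∈ Ri i).Nonempty

variable {D R : Type*} [Fintype D] [Fintype R]

/-- The set `D_j` of demands requiring resource `j`. -/
noncomputable def RAInstance.Dj (I : RAInstance D R) (j : R) : Finset D :=
  Finset.univ.filter fun i => j ∈ I.Ri i

theorem RAInstance.Dj_nonempty' (I : RAInstance D R) (j : R) : (I.Dj j).Nonempty :=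
  I.Dj_nonempty j

/-- `o` is an auction offer for claims `x` on the nonempty finite bidder set `B` with
capacity `c`: with `B* = {b ∈ B : x b < o}` and `A = c - ∑_{b ∈ B*} x b`, we have
`o = A / |B \ B*|` when `B* ≠ B`, and `o = A + max {x b : b ∈ B}` when `B* = B`. -/
def IsAuctionOffer {ι : Type*} (B : Finset ι) (hB : B.Nonempty) (x : ι → ℝ) (c o : ℝ) : Prop :=
  let Bs := B.filter fun b => x b < o
  let A := c - ∑ b ∈ Bs, x b
  if Bs = B then o = A + B.sup' hB x
  else o = A / ((B \ Bs).card : ℝ)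

/-- A stable configuration `(s, o)`: every claim is the minimum of the demand magnitude
and the smallest adjacent offer, and every offer is an auction offer for the adjacent
claims. -/
def IsStableConfig (I : RAInstance D R) (s : D → ℝ) (o : R → ℝ) : Prop :=
  (∀ i, s i = min (I.w i) ((I.Ri i).inf' (I.Ri_nonempty i) o)) ∧
  ∀ j, IsAuctionOffer (I.Dj j) (I.Dj_nonempty' j) s (I.c j) (o j)


/-- An allocation `s` is feasible: `0 ≤ s i ≤ w i` for every demand and the claims at
every resource do not exceed its capacity. -/
def IsFeasible (I : RAInstance D R) (s : D → ℝ) : Prop :=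
  (∀ i, 0 ≤ s i ∧ s i ≤ I.w i) ∧ ∀ j, ∑ i ∈ I.Dj j, s i ≤ I.c j

/-- A feasible allocation `s` is lexicographically max-min if every demand is
satisfied (`s i ≥ w i`) or has a maximal claim at some saturated adjacent resource. -/
def IsLexMaxMin (I : RAInstance D R) (s : D → ℝ) : Prop :=
  IsFeasible I s ∧
  ∀ i, I.w i ≤ s i ∨
    ∃ j ∈ I.Ri i, I.c j ≤ ∑ k ∈ I.Dj j, s k ∧ s i = (I.Dj j).sup' (I.Dj_nonempty' j) s

/-- An auction offer is nonnegative when the capacity is. -/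
theorem IsAuctionOffer.nonneg {ι : Type*} {B : Finset ι} {hB : B.Nonempty} {x : ι → ℝ}
    {c o : ℝ} (h : IsAuctionOffer B hB x c o) (hc : 0 ≤ c) : 0 ≤ o := by
  by_contra! ho
  unfold IsAuctionOffer at h
  simp only at h
  split_ifs at h with hBs
  · obtain ⟨b, hb, hmax⟩ := B.exists_mem_eq_sup' hB x
    have hlt := Finset.filter_eq_self.1 hBs
    have hsum := Finset.add_sum_erase B x hb
    have hrest : ∑ k ∈ B.erase b, x k ≤ 0 :=
      Finset.sum_nonpos fun k hk => ((hlt _ (Finset.mem_of_mem_erase hk)).trans ho).le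
    rw [hBs, hmax] at h
    linarith
  · have hsum : ∑ k ∈ B.filter (fun b => x b < o), x k ≤ 0 :=
      Finset.sum_nonpos fun k hk => ((Finset.mem_filter.1 hk).2.trans ho).le
    have : 0 ≤ o := by
      rw [h]
      exact div_nonneg (by linarith) (Nat.cast_nonneg _)
    linarith

/-- If no bid exceeds the offer and some bid attains it, the bids exhaust the capacity. -/
theorem IsAuctionOffer.sum_eq {ι : Type*} {B : Finset ι} {hB : B.Nonempty} {x : ι → ℝ}
    {c o : ℝ} (h : IsAuctionOffer B hB x c o) (hle : ∀ b ∈ B, x b ≤ o)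
    (hex : B.filter (fun b => x b < o) ≠ B) : ∑ b ∈ B, x b = c := by
  unfold IsAuctionOffer at h
  simp only [if_neg hex] at h
  have hsub := Finset.filter_subset (fun b => x b < o) B
  have hcard : ((B \ B.filter fun b => x b < o).card : ℝ) ≠ 0 := by
    rw [Nat.cast_ne_zero, Finset.card_ne_zero, Finset.sdiff_nonempty]
    exact fun h' => hex (hsub.antisymm h')
  have hsum : ∑ b ∈ B \ B.filter (fun b => x b < o), x b
      = ((B \ B.filter fun b => x b < o).card : ℝ) * o := by
    rw [← nsmul_eq_mul]
    refine Finset.sum_eq_card_nsmul fun b hb => ?_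
    obtain ⟨hb, hnot⟩ := Finset.mem_sdiff.1 hb
    exact (hle b hb).antisymm (not_lt.1 fun hlt => hnot (Finset.mem_filter.2 ⟨hb, hlt⟩))
  rw [eq_div_iff hcard] at h
  have := Finset.sum_sdiff (f := x) hsub
  linarith

/-- If no bid exceeds the offer, the bids respect the capacity. -/
theorem IsAuctionOffer.sum_le {ι : Type*} {B : Finset ι} {hB : B.Nonempty} {x : ι → ℝ}
    {c o : ℝ} (h : IsAuctionOffer B hB x c o) (hle : ∀ b ∈ B, x b ≤ o) :
    ∑ b ∈ B, x b ≤ c := by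
  by_cases hBs : B.filter (fun b => x b < o) = B
  · unfold IsAuctionOffer at h
    simp only [if_pos hBs] at h
    rw [hBs] at h
    have := Finset.sup'_le hB x hle
    linarith
  · exact (h.sum_eq hle hBs).le

/-- In a stable configuration, the allocation `s` is lexicographically max-min. -/
theorem stable_config_lex_max_min
    (I : RAInstance D R) (s : D → ℝ) (o : R → ℝ)
    (h : IsStableConfig I s o) :
    IsLexMaxMin I s := by
  obtain ⟨hs, ho⟩ := h
  have hmem {i j} : i ∈ I.Dj j ↔ j ∈ I.Ri i := by simp [RAInstance.Dj]
  have hle : ∀ j, ∀ i ∈ I.Dj j, s i ≤ o j := fun j i hi => by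
    rw [hs i]
    exact (min_le_right _ _).trans (Finset.inf'_le _ (hmem.1 hi))
  refine ⟨⟨fun i => ⟨?_, ?_⟩, fun j => (ho j).sum_le (hle j)⟩, fun i => ?_⟩
  · rw [hs i]
    exact le_min (I.w_nonneg i)
      (Finset.le_inf' _ _ fun j _ => (ho j).nonneg (I.c_nonneg j))
  · rw [hs i]
    exact min_le_left _ _
  · rcases min_choice (I.w i) ((I.Ri i).inf' (I.Ri_nonempty i) o) with hw | hw
    · exact Or.inl (by rw [hs i, hw])
    · obtain ⟨j, hj, hmin⟩ := (I.Ri i).exists_mem_eq_inf' (I.Ri_nonempty i) o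
      have hsi : s i = o j := by rw [hs i, hw, hmin]
      refine Or.inr ⟨j, hj, ((ho j).sum_eq (hle j) fun hBs => ?_).ge, ?_⟩
      · exact (Finset.filter_eq_self.1 hBs _ (hmem.2 hj)).ne hsi
      · exact (Finset.le_sup' s (hmem.2 hj)).antisymm
          (Finset.sup'_le _ _ fun k hk => (hle j k hk).trans hsi.ge)
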